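/- arXiv:2007.05321 — 2 statements merged into one kernel-verified Lean document; each statement's English description precedes it below -/
import Mathlib

section
/- Let A be an Artin algebra and (C,T) an n-tilting pair of self-orthogonal modules in mod A. Then T^⊥ ⊆ C^⊥, i.e. every module Y with Ext^i(T,Y)=0 for all i≥1 also satisfies Ext^i(C,Y)=0 for all i≥1. -/
open CategoryTheory CategoryTheory.Limits Opposite

noncomputable section

universe v u

variable (C : Type u) [Category.{v} C] [Abelian C] [EnoughProjectives C] [EnoughInjectives C]

/-- The `i`-th Ext group from `X` to `Y` vanishes. -/
def extZero (i : ℕ) (X Y : C) : Prop :=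
  Limits.IsZero (((Ext ℤ C i).obj (op X)).obj Y)

variable {C}

/-- A class of objects is self-orthogonal if all positive-degree Ext groups
between its members vanish. -/
def SelfOrth (ω : Set C) : Prop :=
  ∀ W ∈ ω, ∀ W' ∈ ω, ∀ i ≥ 1, extZero C i W W'

/-- The right orthogonal class `ω^⊥`. -/
def rightPerp (ω : Set C) : Set C :=
  {Y | ∀ W ∈ ω, ∀ i ≥ 1, extZero C i W Y}

/-- The left orthogonal class `^⊥ω`. -/
def leftPerp (ω : Set C) : Set C :=
  {Y | ∀ W ∈ ω, ∀ i ≥ 1, extZero C i Y W}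

/-- There exists a short exact sequence `0 → X → Y → Z → 0`. -/
def SES (X Y Z : C) : Prop :=
  ∃ (f : X ⟶ Y) (g : Y ⟶ Z) (w : f ≫ g = 0), (ShortComplex.mk f g w).ShortExact

/-- `coresol ω n` is the class of objects admitting an `ω`-coresolution
`0 → X → W⁰ → ⋯ → Wⁿ → 0` of length `n`. -/
def coresol (ω : Set C) : ℕ → Set C
  | 0 => {X | ∃ W ∈ ω, Nonempty (X ≅ W)}
  | n + 1 => {X | ∃ W ∈ ω, ∃ X', SES X W X' ∧ X' ∈ coresol ω n}

/-- `check(ω)`: objects with a finite `ω`-coresolution. -/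
def checkCat (ω : Set C) : Set C := ⋃ n, coresol ω n

/-- `resol ω n` is the class of objects admitting an `ω`-resolution
`0 → Wₙ → ⋯ → W₀ → X → 0` of length `n`. -/
def resol (ω : Set C) : ℕ → Set C
  | 0 => {X | ∃ W ∈ ω, Nonempty (X ≅ W)}
  | n + 1 => {X | ∃ W ∈ ω, ∃ X', SES X' W X ∧ X' ∈ resol ω n}

/-- `hat(ω)`: objects with a finite `ω`-resolution. -/
def hatCat (ω : Set C) : Set C := ⋃ n, resol ω n

/-- `_ωX`: objects admitting an exact proper `ω`-resolution
`⋯ → W₁ → W₀ → A → 0` with all syzygies in `ω^⊥`. -/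
def omX (ω : Set C) : Set C :=
  {A | ∃ K W : ℕ → C, K 0 = A ∧ (∀ i, W i ∈ ω) ∧
    (∀ i, K (i + 1) ∈ rightPerp ω) ∧ ∀ i, SES (K (i + 1)) (W i) (K i)}

/-- `X_ω`: objects admitting an exact coproper `ω`-coresolution
`0 → A → W⁰ → W¹ → ⋯` with all cosyzygies in `^⊥ω`. -/
def Xom (ω : Set C) : Set C :=
  {A | ∃ K W : ℕ → C, K 0 = A ∧ (∀ i, W i ∈ ω) ∧
    (∀ i, K (i + 1) ∈ leftPerp ω) ∧ ∀ i, SES (K i) (W i) (K (i + 1))}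

/-- `Pres^n_D(ω)`: objects `M` with an exact sequence
`0 → X → Tₙ → ⋯ → T₁ → M → 0`, `Tᵢ ∈ ω`, `X ∈ D`. -/
def Pres (D ω : Set C) : ℕ → Set C
  | 0 => D
  | n + 1 => {M | ∃ T ∈ ω, ∃ X, SES X T M ∧ X ∈ Pres D ω n}

/-- `ω`-codimension: the least length of an `ω`-coresolution. -/
def codim (ω : Set C) (M : C) : ℕ := sInf {n | M ∈ coresol ω n}

/-- `I` is a relative injective cogenerator of `Y`. -/
def RelInjCogen (I Y : Set C) : Prop :=
  I ⊆ Y ∧ (∀ X ∈ I, ∀ Z ∈ Y, ∀ i ≥ 1, extZero C i Z X) ∧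
    ∀ Z ∈ Y, ∃ I₀ ∈ I, ∃ Z', Z' ∈ Y ∧ SES Z I₀ Z'

/-- The direct sum of `n + 1` copies of `T`. -/
def nsum (T : C) : ℕ → C
  | 0 => T
  | n + 1 => T ⊞ nsum T n

/-- `add T`: direct summands of finite direct sums of copies of `T`. -/
def addOf (T : C) : Set C :=
  {X | ∃ (n : ℕ) (Y : C), Nonempty ((X ⊞ Y) ≅ nsum T n)}


section ArtinAlgebra

variable (R : Type) [CommRing R] [IsArtinianRing R]
variable (A : Type) [Ring A] [Algebra R A] [Module.Finite R A]
variable [Abelian (FGModuleCat A)] [EnoughProjectives (FGModuleCat A)]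
variable [EnoughInjectives (FGModuleCat A)]

/-- `M` is a self-orthogonal module: `Ext^i(M, M) = 0` for all `i ≥ 1`. -/
def SelfOrthMod (M : FGModuleCat A) : Prop :=
  ∀ i ≥ 1, extZero (FGModuleCat A) i M M

/-- `(C, T)` is a tilting pair in `mod A`. -/
def TiltingPair (Cm Tm : FGModuleCat A) : Prop :=
  SelfOrthMod A Cm ∧ SelfOrthMod A Tm ∧
    Tm ∈ hatCat (addOf Cm) ∧ Cm ∈ checkCat (addOf Tm)

/-- `(C, T)` is an `n`-tilting pair: a tilting pair with `add C`-resolution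
dimension of `add T` at most `n`. -/
def nTiltingPair (Cm Tm : FGModuleCat A) (n : ℕ) : Prop :=
  TiltingPair A Cm Tm ∧ ∀ X ∈ addOf Tm, X ∈ resol (addOf Cm) n

end ArtinAlgebra

section ExtVanishing

variable {D : Type u} [Category.{v} D] [Abelian D]

attribute [local instance] HasExt.standard

lemma subsingleton_ext_of_retract {X X' Y : D} (r : Retract X X') (i : ℕ)
    [Subsingleton (Abelian.Ext X' Y i)] : Subsingleton (Abelian.Ext X Y i) := by
  refine subsingleton_of_forall_eq 0 fun α ↦ ?_
  have h : (Abelian.Ext.mk₀ r.r).comp α (zero_add i) = 0 := Subsingleton.elim _ _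
  rw [← Abelian.Ext.mk₀_id_comp α, ← r.retract, ← Abelian.Ext.mk₀_comp_mk₀_assoc, h,
    Abelian.Ext.comp_zero]

lemma subsingleton_ext_nsum {T Y : D} (i : ℕ) [Subsingleton (Abelian.Ext T Y i)] (n : ℕ) :
    Subsingleton (Abelian.Ext (nsum T n) Y i) := by
  induction n with
  | zero => assumption
  | succ n ih => exact (Abelian.Ext.biprodAddEquiv (X₁ := T) (X₂ := nsum T n)).subsingleton

variable [EnoughProjectives D]

/-- In positive degrees, the vanishing of the derived-functor `Ext` is equivalent to the vanishing
of the `Ext` defined through the derived category. -/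
lemma extZero_succ_iff (i : ℕ) (X Y : D) :
    extZero D (i + 1) X Y ↔ Subsingleton (Abelian.Ext X Y (i + 1)) := by
  let P := projectiveResolution X
  rw [extZero, (P.isoExt (R := ℤ) (i + 1) Y).isZero_iff,
    ← HomologicalComplex.exactAt_iff_isZero_homology,
    HomologicalComplex.exactAt_iff' _ i (i + 1) (i + 2) (by simp) (by simp),
    ShortComplex.moduleCat_exact_iff]
  constructor
  · refine fun h ↦ subsingleton_of_forall_eq 0 fun α ↦ ?_
    obtain ⟨f, hf, rfl⟩ := P.extMk_surjective α (i + 2) rfl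
    exact (P.extMk_eq_zero_iff f _ rfl hf i rfl).2 (h f hf)
  · intro _ f hf
    exact (P.extMk_eq_zero_iff f (i + 2) rfl hf i rfl).1 (Subsingleton.elim _ _)

lemma mem_rightPerp_addOf {T Y : D} (h : ∀ i ≥ 1, extZero D i T Y) :
    Y ∈ rightPerp (addOf T) := by
  rintro W ⟨n, Z, ⟨e⟩⟩ (_ | i) hi
  · omega
  have := (extZero_succ_iff i T Y).1 (h _ hi)
  have := subsingleton_ext_nsum (T := T) (Y := Y) (i + 1) n
  exact (extZero_succ_iff i W Y).2 (subsingleton_ext_of_retract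
    { i := biprod.inl ≫ e.hom, r := e.inv ≫ biprod.fst } (i + 1))

/-- Dimension shifting along a finite coresolution. -/
lemma extZero_of_mem_coresol {ω : Set D} {Y : D} (hY : Y ∈ rightPerp ω) (n : ℕ) {X : D}
    (hX : X ∈ coresol ω n) : ∀ i ≥ 1, extZero D i X Y := by
  induction n generalizing X with
  | zero =>
    obtain ⟨W, hW, ⟨e⟩⟩ := hX
    rintro (_ | i) hi
    · omega
    have := (extZero_succ_iff i W Y).1 (hY W hW _ hi)
    exact (extZero_succ_iff i X Y).2
      (subsingleton_ext_of_retract (Retract.ofIso e) (i + 1))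
  | succ n ih =>
    obtain ⟨W, hW, X', ⟨f, g, w, hS⟩, hX'⟩ := hX
    rintro (_ | i) hi
    · omega
    have h₂ := (extZero_succ_iff i W Y).1 (hY W hW _ hi)
    have h₃ := (extZero_succ_iff (i + 1) X' Y).1 (ih hX' _ (by omega))
    refine (extZero_succ_iff i X Y).2 (subsingleton_of_forall_eq 0 fun α ↦ ?_)
    obtain ⟨β, rfl⟩ := Abelian.Ext.contravariant_sequence_exact₁ hS Y α
      (n₁ := i + 2) (by omega) (Subsingleton.elim _ _)
    rw [Subsingleton.elim β 0, Abelian.Ext.comp_zero]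

end ExtVanishing

section ArtinAlgebra

variable {R : Type} [CommRing R] [IsArtinianRing R]
variable {A : Type} [Ring A] [Algebra R A] [Module.Finite R A]
variable [Abelian (FGModuleCat A)] [EnoughProjectives (FGModuleCat A)]
variable [EnoughInjectives (FGModuleCat A)]

theorem stmt12 (Cm Tm : FGModuleCat A) (n : ℕ)
    (htilt : nTiltingPair A Cm Tm n) :
    ∀ Y : FGModuleCat A, (∀ i ≥ 1, extZero (FGModuleCat A) i Tm Y) →
      ∀ i ≥ 1, extZero (FGModuleCat A) i Cm Y := by
  intro Y hY
  obtain ⟨m, hm⟩ := Set.mem_iUnion.1 htilt.1.2.2.2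
  exact extZero_of_mem_coresol (mem_rightPerp_addOf hY) m hm

end ArtinAlgebra
end
end

section
/- Let A be an Artin algebra and (C,T) a tilting pair of self-orthogonal modules in mod A. Then check(_TX) = check(_CX): a module has a finite coresolution by modules of _TX if and only if it has a finite coresolution by modules of _CX. -/
open CategoryTheory CategoryTheory.Limits Opposite

noncomputable section

universe v u

variable (C : Type u) [Category.{v} C] [Abelian C] [EnoughProjectives C] [EnoughInjectives C]

variable {C}

section ShortExactSequences

open scoped ZeroObject

variable {D : Type u} [Category.{v} D] [Abelian D]

lemma shortExact_of_desc {X Y Z : D} (f : X ⟶ Y) (g : Y ⟶ Z) (w : f ≫ g = 0) [Mono f] [Epi g]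
    (h : ∀ (A : D) (k : Y ⟶ A), f ≫ k = 0 → ∃ l, g ≫ l = k) :
    (ShortComplex.mk f g w).ShortExact where
  exact := ShortComplex.exact_of_g_is_cokernel _ (CokernelCofork.IsColimit.ofπ' g w
    (fun {A} k hk => ⟨(h A k hk).choose, (h A k hk).choose_spec⟩))
  mono_f := ‹_›
  epi_g := ‹_›

lemma shortExact_of_lift {X Y Z : D} (f : X ⟶ Y) (g : Y ⟶ Z) (w : f ≫ g = 0) [Mono f] [Epi g]
    (h : ∀ (A : D) (k : A ⟶ Y), k ≫ g = 0 → ∃ l, l ≫ f = k) :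
    (ShortComplex.mk f g w).ShortExact where
  exact := ShortComplex.exact_of_f_is_kernel _ (KernelFork.IsLimit.ofι' f w
    (fun {A} k hk => ⟨(h A k hk).choose, (h A k hk).choose_spec⟩))
  mono_f := ‹_›
  epi_g := ‹_›

lemma CategoryTheory.IsPushout.exists_shortExact {X Y Z X' P : D} {f : X ⟶ Y} {a : X ⟶ X'}
    {b : Y ⟶ P} {f' : X' ⟶ P} (sq : IsPushout f a b f') {g : Y ⟶ Z} {w : f ≫ g = 0}
    (hS : (ShortComplex.mk f g w).ShortExact) :
    ∃ (g' : P ⟶ Z) (w' : f' ≫ g' = 0), b ≫ g' = g ∧ (ShortComplex.mk f' g' w').ShortExact := by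
  have : Mono f := hS.mono_f
  have : Epi g := hS.epi_g
  have : Mono f' := Abelian.mono_inr_of_isColimit _ _ sq.isColimit
  have hb : b ≫ sq.desc g 0 (by simp [w]) = g := sq.inl_desc _ _ _
  have : Epi (sq.desc g 0 (by simp [w])) := epi_of_epi_fac hb
  refine ⟨_, sq.inr_desc _ _ _, hb,
    shortExact_of_desc _ _ _ fun A k hk => ?_⟩
  refine ⟨hS.exact.desc (b ≫ k) (by simp [sq.w_assoc, hk]), sq.hom_ext ?_ ?_⟩
  · simpa using hS.exact.g_desc _ _
  · simp [hk]

lemma CategoryTheory.IsPullback.exists_shortExact {X Y Z Z' P : D} {g : Y ⟶ Z} {a : Z' ⟶ Z}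
    {b : P ⟶ Y} {g' : P ⟶ Z'} (sq : IsPullback b g' g a) {f : X ⟶ Y} {w : f ≫ g = 0}
    (hS : (ShortComplex.mk f g w).ShortExact) :
    ∃ (f' : X ⟶ P) (w' : f' ≫ g' = 0), f' ≫ b = f ∧ (ShortComplex.mk f' g' w').ShortExact := by
  have : Mono f := hS.mono_f
  have : Epi g := hS.epi_g
  have : Epi g' := Abelian.epi_snd_of_isLimit _ _ sq.isLimit
  have hb : sq.lift f 0 (by simp [w]) ≫ b = f := sq.lift_fst _ _ _
  have : Mono (sq.lift f 0 (by simp [w])) := mono_of_mono_fac hb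
  refine ⟨_, sq.lift_snd _ _ _, hb,
    shortExact_of_lift _ _ _ fun A k hk => ?_⟩
  refine ⟨hS.exact.lift (k ≫ b) (by simp [sq.w, reassoc_of% hk]), sq.hom_ext ?_ ?_⟩
  · simpa using hS.exact.lift_f _ _
  · simp [hk]

namespace SES

lemma of_iso {X Y Z X' Y' Z' : D} (h : SES X Y Z) (a : X ≅ X') (b : Y ≅ Y') (c : Z ≅ Z') :
    SES X' Y' Z' := by
  obtain ⟨f, g, w, hS⟩ := h
  refine ⟨a.inv ≫ f ≫ b.hom, b.inv ≫ g ≫ c.hom, by simp [reassoc_of% w], ?_⟩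
  exact ShortComplex.shortExact_of_iso (ShortComplex.isoMk a b c (by simp) (by simp)) hS

lemma pushout {X Y Z X' V : D} (h : SES X Y Z) (h' : SES X X' V) :
    ∃ P, SES X' P Z ∧ SES Y P V := by
  obtain ⟨f, g, w, hS⟩ := h
  obtain ⟨f', g', w', hS'⟩ := h'
  have sq := IsPushout.of_hasPushout f f'
  obtain ⟨p, hp, -, h₁⟩ := sq.exists_shortExact hS
  obtain ⟨q, hq, -, h₂⟩ := sq.flip.exists_shortExact hS'
  exact ⟨_, ⟨_, _, hp, h₁⟩, ⟨_, _, hq, h₂⟩⟩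

lemma pullback {X Y Z Z' V : D} (h : SES X Y Z) (h' : SES V Z' Z) :
    ∃ P, SES X P Z' ∧ SES V P Y := by
  obtain ⟨f, g, w, hS⟩ := h
  obtain ⟨f', g', w', hS'⟩ := h'
  have sq := IsPullback.of_hasPullback g g'
  obtain ⟨p, hp, -, h₁⟩ := sq.exists_shortExact hS
  obtain ⟨q, hq, -, h₂⟩ := sq.flip.exists_shortExact hS'
  exact ⟨_, ⟨_, _, hp, h₁⟩, ⟨_, _, hq, h₂⟩⟩

lemma comp_mono {X Y Z Y' V : D} (h : SES X Y Z) (h' : SES Y Y' V) :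
    ∃ E, SES X Y' E ∧ SES Z E V := by
  obtain ⟨f, g, w, hS⟩ := h
  obtain ⟨a, q, w', hS'⟩ := h'
  have : Mono f := hS.mono_f
  have : Epi g := hS.epi_g
  have : Mono a := hS'.mono_f
  have sq := IsPushout.of_hasPushout a g
  obtain ⟨p, hp, -, h₁⟩ := sq.exists_shortExact hS'
  have hfa : (f ≫ a) ≫ Limits.pushout.inl a g = 0 := by
    rw [Category.assoc, sq.w, reassoc_of% w, zero_comp]
  refine ⟨_, ⟨f ≫ a, _, hfa, shortExact_of_desc _ _ _ fun A k hk => ?_⟩, ⟨_, _, hp, h₁⟩⟩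
  exact ⟨sq.desc k (hS.exact.desc (a ≫ k) (by simpa using hk)) (hS.exact.g_desc _ _).symm,
    sq.inl_desc _ _ _⟩

lemma comp_epi {X Y Z V Z' : D} (h : SES X Y Z) (h' : SES V Z Z') :
    ∃ E, SES X E V ∧ SES E Y Z' := by
  obtain ⟨f, g, w, hS⟩ := h
  obtain ⟨a, q, w', hS'⟩ := h'
  have : Epi g := hS.epi_g
  have : Mono a := hS'.mono_f
  have : Epi q := hS'.epi_g
  have sq := IsPullback.of_hasPullback g a
  obtain ⟨p, hp, -, h₁⟩ := sq.exists_shortExact hS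
  have hgq : Limits.pullback.fst g a ≫ g ≫ q = 0 := by
    rw [sq.w_assoc, w', comp_zero]
  refine ⟨_, ⟨_, _, hp, h₁⟩, ⟨_, g ≫ q, hgq, shortExact_of_lift _ _ _ fun A k hk => ?_⟩⟩
  exact ⟨sq.lift k (hS'.exact.lift (k ≫ g) (by simpa using hk)) (hS'.exact.lift_f _ _).symm,
    sq.lift_fst _ _ _⟩

lemma biprod_inl (X Y : D) : SES X (X ⊞ Y) Y :=
  ⟨biprod.inl, biprod.snd, by simp, shortExact_of_lift _ _ _ fun A k hk =>
    ⟨k ≫ biprod.fst, by ext <;> simp [hk]⟩⟩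

lemma biprod_inr (X Y : D) : SES Y (X ⊞ Y) X :=
  (biprod_inl Y X).of_iso (Iso.refl _) (biprod.braiding _ _) (Iso.refl _)

lemma id_zero (X : D) : SES X X 0 :=
  ⟨𝟙 X, 0, by simp, shortExact_of_desc _ _ _ fun A k hk => ⟨0, by simpa using hk.symm⟩⟩

lemma zero_id (X : D) : SES 0 X X :=
  ⟨0, 𝟙 X, by simp, shortExact_of_lift _ _ _ fun A k hk => ⟨0, by simpa using hk.symm⟩⟩

lemma biprod_right {X Y Z : D} (h : SES X Y Z) (B : D) : SES X (Y ⊞ B) (Z ⊞ B) := by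
  obtain ⟨f, g, w, hS⟩ := h
  have : Mono f := hS.mono_f
  have : Epi g := hS.epi_g
  refine ⟨f ≫ biprod.inl, biprod.map g (𝟙 B), by simp [reassoc_of% w],
    shortExact_of_lift _ _ _ fun A k hk => ?_⟩
  have h₁ : k ≫ biprod.fst ≫ g = 0 := by simpa using hk =≫ biprod.fst
  have h₂ : k ≫ biprod.snd = 0 := by simpa using hk =≫ biprod.snd
  refine ⟨hS.exact.lift (k ≫ biprod.fst) (by simpa using h₁), ?_⟩
  have h₃ := hS.exact.lift_f (k ≫ biprod.fst) (by simpa using h₁)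
  dsimp at h₃
  ext
  · simp [h₃]
  · simp [h₂]

lemma biprod_left {X Y Z : D} (h : SES X Y Z) (B : D) : SES (B ⊞ X) (B ⊞ Y) Z := by
  obtain ⟨f, g, w, hS⟩ := h
  have : Mono f := hS.mono_f
  have : Epi g := hS.epi_g
  refine ⟨biprod.map (𝟙 B) f, biprod.snd ≫ g, by simp [w],
    shortExact_of_desc _ _ _ fun A k hk => ?_⟩
  have h₁ : biprod.inl ≫ k = 0 := by simpa using biprod.inl ≫= hk
  have h₂ : f ≫ biprod.inr ≫ k = 0 := by simpa using biprod.inr ≫= hk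
  have h₃ := hS.exact.g_desc (biprod.inr ≫ k) (by simpa using h₂)
  dsimp at h₃
  refine ⟨hS.exact.desc (biprod.inr ≫ k) (by simpa using h₂), ?_⟩
  ext
  · simp [h₁]
  · simp [h₃]

end SES

end ShortExactSequences

section ExtVanishing

set_option linter.unusedSectionVars false

variable {D : Type u} [Category.{v} D] [Abelian D] [EnoughProjectives D]

lemma extZero_iff [HasExt.{v} D] (n : ℕ) (X Y : D) :
    extZero D (n + 1) X Y ↔ ∀ e : Abelian.Ext.{v} X Y (n + 1), e = 0 := by
  let P := ProjectiveResolution.of X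
  rw [extZero, (P.isoExt (R := ℤ) (n + 1) Y).isZero_iff,
    ← HomologicalComplex.exactAt_iff_isZero_homology,
    HomologicalComplex.exactAt_iff' _ n (n + 1) (n + 2) (by simp) (by simp),
    ShortComplex.moduleCat_exact_iff]
  constructor
  · intro h e
    obtain ⟨f, hf, rfl⟩ := P.extMk_surjective e (n + 2) rfl
    rw [P.extMk_eq_zero_iff f (n + 2) rfl hf n rfl]
    exact h f hf
  · intro h (f : P.complex.X (n + 1) ⟶ Y) hf
    exact (P.extMk_eq_zero_iff f (n + 2) rfl hf n rfl).1 (h _)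

namespace SES

lemma extZero_mid {X Y Z : D} (h : SES X Y Z) {W : D} {i : ℕ} (hi : i ≥ 1)
    (h₁ : extZero D i W X) (h₃ : extZero D i W Z) : extZero D i W Y := by
  have : HasExt.{v} D := hasExt_of_enoughProjectives.{v} D
  obtain ⟨i, rfl⟩ := Nat.exists_eq_add_of_le' hi
  obtain ⟨f, g, w, hS⟩ := h
  rw [extZero_iff] at *
  intro e
  obtain ⟨x, rfl⟩ := Abelian.Ext.covariant_sequence_exact₂ W hS e (h₃ _)
  rw [h₁ x, Abelian.Ext.zero_comp]

lemma extZero_right {X Y Z : D} (h : SES X Y Z) {W : D} {i : ℕ} (hi : i ≥ 1)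
    (h₂ : extZero D i W Y) (h₁ : extZero D (i + 1) W X) : extZero D i W Z := by
  have : HasExt.{v} D := hasExt_of_enoughProjectives.{v} D
  obtain ⟨i, rfl⟩ := Nat.exists_eq_add_of_le' hi
  obtain ⟨f, g, w, hS⟩ := h
  rw [extZero_iff] at *
  intro e
  obtain ⟨x, rfl⟩ := Abelian.Ext.covariant_sequence_exact₃ W hS e rfl (h₁ _)
  rw [h₂ x, Abelian.Ext.zero_comp]

lemma extZero_source_left {X Y Z : D} (h : SES X Y Z) {W : D} {i : ℕ} (hi : i ≥ 1)
    (h₂ : extZero D i Y W) (h₃ : extZero D (i + 1) Z W) : extZero D i X W := by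
  have : HasExt.{v} D := hasExt_of_enoughProjectives.{v} D
  obtain ⟨i, rfl⟩ := Nat.exists_eq_add_of_le' hi
  obtain ⟨f, g, w, hS⟩ := h
  rw [extZero_iff] at *
  intro e
  obtain ⟨x, rfl⟩ := Abelian.Ext.contravariant_sequence_exact₁ hS W e (add_comm 1 (i + 1)) (h₃ _)
  rw [h₂ x, Abelian.Ext.comp_zero]

lemma extZero_source_mid {X Y Z : D} (h : SES X Y Z) {W : D} {i : ℕ} (hi : i ≥ 1)
    (h₁ : extZero D i X W) (h₃ : extZero D i Z W) : extZero D i Y W := by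
  have : HasExt.{v} D := hasExt_of_enoughProjectives.{v} D
  obtain ⟨i, rfl⟩ := Nat.exists_eq_add_of_le' hi
  obtain ⟨f, g, w, hS⟩ := h
  rw [extZero_iff] at *
  intro e
  obtain ⟨x, rfl⟩ := Abelian.Ext.contravariant_sequence_exact₂ hS W e (h₁ _)
  rw [h₃ x, Abelian.Ext.comp_zero]

lemma extZero_source_right {X Y Z : D} (h : SES X Y Z) {W : D} {i : ℕ} (hi : i ≥ 1)
    (h₁ : extZero D i X W) (h₂ : extZero D (i + 1) Y W) : extZero D (i + 1) Z W := by
  have : HasExt.{v} D := hasExt_of_enoughProjectives.{v} D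
  obtain ⟨i, rfl⟩ := Nat.exists_eq_add_of_le' hi
  obtain ⟨f, g, w, hS⟩ := h
  rw [extZero_iff] at *
  intro e
  obtain ⟨x, rfl⟩ := Abelian.Ext.contravariant_sequence_exact₃ hS W e (h₂ _) (add_comm 1 (i + 1))
  rw [h₁ x, Abelian.Ext.comp_zero]

lemma nonempty_iso_biprod {X Y Z : D} (h : SES X Y Z) (h₁ : extZero D 1 Z X) :
    Nonempty (Y ≅ X ⊞ Z) := by
  have : HasExt.{v} D := hasExt_of_enoughProjectives.{v} D
  obtain ⟨f, g, w, hS⟩ := h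
  rw [extZero_iff 0] at h₁
  obtain ⟨s, hs⟩ := Abelian.Ext.covariant_sequence_exact₃ Z hS (Abelian.Ext.mk₀ (𝟙 Z)) rfl (h₁ _)
  obtain ⟨s, rfl⟩ := Abelian.Ext.mk₀_bijective _ _ |>.2 s
  rw [Abelian.Ext.mk₀_comp_mk₀] at hs
  have := hS.mono_f
  exact ⟨(ShortComplex.Splitting.ofExactOfSection _ hS.exact s
    ((Abelian.Ext.mk₀_bijective _ _).1 hs) inferInstance).isoBinaryBiproduct⟩

end SES

lemma extZero_of_retract_target {W X Y : D} (r : Retract X Y) {i : ℕ} (hi : i ≥ 1)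
    (h : extZero D i W Y) : extZero D i W X := by
  have : HasExt.{v} D := hasExt_of_enoughProjectives.{v} D
  obtain ⟨i, rfl⟩ := Nat.exists_eq_add_of_le' hi
  rw [extZero_iff] at *
  intro e
  rw [← e.comp_mk₀_id, ← r.retract, ← Abelian.Ext.mk₀_comp_mk₀,
    ← Abelian.Ext.comp_assoc_of_third_deg_zero, h (e.comp _ _), Abelian.Ext.zero_comp]

lemma extZero_of_retract_source {W X Y : D} (r : Retract X Y) {i : ℕ} (hi : i ≥ 1)
    (h : extZero D i Y W) : extZero D i X W := by
  have : HasExt.{v} D := hasExt_of_enoughProjectives.{v} D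
  obtain ⟨i, rfl⟩ := Nat.exists_eq_add_of_le' hi
  rw [extZero_iff] at *
  intro e
  rw [← e.mk₀_id_comp, ← r.retract, ← Abelian.Ext.mk₀_comp_mk₀_assoc,
    h ((Abelian.Ext.mk₀ r.r).comp e (zero_add _)), Abelian.Ext.comp_zero]


lemma extZero_of_isZero {W X : D} (hX : IsZero X) {i : ℕ} (hi : i ≥ 1) : extZero D i W X := by
  have : HasExt.{v} D := hasExt_of_enoughProjectives.{v} D
  obtain ⟨i, rfl⟩ := Nat.exists_eq_add_of_le' hi
  rw [extZero_iff]
  intro e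
  rw [← e.comp_mk₀_id, hX.eq_of_src (𝟙 X) 0, Abelian.Ext.mk₀_zero, Abelian.Ext.comp_zero]

lemma retract_biprod_left (X Y : D) : Nonempty (Retract X (X ⊞ Y)) :=
  ⟨⟨biprod.inl, biprod.fst, by simp⟩⟩

end ExtVanishing

section RelativeResolutions

open scoped ZeroObject

set_option linter.unusedSectionVars false

variable {D : Type u} [Category.{v} D] [Abelian D] [EnoughProjectives D]

/-- A class of objects closed under isomorphisms and finite direct sums. -/
structure IsAddClosed (ω : Set D) : Prop where
  zero_mem : (0 : D) ∈ ω
  of_iso {X Y : D} : X ∈ ω → (X ≅ Y) → Y ∈ ω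
  biprod_mem {X Y : D} : X ∈ ω → Y ∈ ω → (X ⊞ Y) ∈ ω

lemma omX_subset_rightPerp {ω : Set D} (ho : SelfOrth ω) : omX ω ⊆ rightPerp ω := by
  rintro _ ⟨K, W, rfl, hW, hK, hS⟩ V hV i hi
  exact (hS 0).extZero_right hi (ho V hV _ (hW 0) i hi) (hK 0 V hV _ (by omega))

lemma SES.of_iso_right {X Y Z Z' : D} (h : SES X Y Z) (e : Z ≅ Z') : SES X Y Z' :=
  h.of_iso (Iso.refl _) (Iso.refl _) e

lemma SES.of_iso_mid {X Y Z Y' : D} (h : SES X Y Z) (e : Y ≅ Y') : SES X Y' Z :=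
  h.of_iso (Iso.refl _) e (Iso.refl _)

lemma SES.of_iso_left {X Y Z X' : D} (h : SES X Y Z) (e : X ≅ X') : SES X' Y Z :=
  h.of_iso e (Iso.refl _) (Iso.refl _)

lemma exists_ses_of_mem_omX {ω : Set D} {X : D} (hX : X ∈ omX ω) :
    ∃ W ∈ ω, ∃ K ∈ omX ω, SES K W X := by
  obtain ⟨K, W, rfl, hW, hK, hS⟩ := hX
  exact ⟨W 0, hW 0, K 1, ⟨fun i => K (i + 1), fun i => W (i + 1), rfl, fun i => hW _,
    fun i => hK _, fun i => hS _⟩, hS 0⟩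

lemma mem_omX_of_ses {ω : Set D} (ho : SelfOrth ω) {K W X : D} (h : SES K W X) (hW : W ∈ ω)
    (hK : K ∈ omX ω) : X ∈ omX ω := by
  have hp := omX_subset_rightPerp ho hK
  obtain ⟨K, V, rfl, hV, hK, hS⟩ := hK
  refine ⟨fun i => Nat.casesOn i X K, fun i => Nat.casesOn i W V, rfl, ?_, ?_, ?_⟩
  · rintro (_ | i)
    exacts [hW, hV i]
  · rintro (_ | i)
    exacts [hp, hK i]
  · rintro (_ | i)
    exacts [h, hS i]

lemma subset_omX_of_forall_exists {ω 𝒦 : Set D} (hp : 𝒦 ⊆ rightPerp ω)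
    (h : ∀ X ∈ 𝒦, ∃ W ∈ ω, ∃ K ∈ 𝒦, SES K W X) : 𝒦 ⊆ omX ω := by
  choose! W hW K hK hS using h
  intro X hX
  have hmem : ∀ i, K^[i] X ∈ 𝒦 := fun i => by
    induction i with
    | zero => exact hX
    | succ i ih => rw [Function.iterate_succ_apply']; exact hK _ ih
  refine ⟨fun i => K^[i] X, fun i => W (K^[i] X), rfl, fun i => hW _ (hmem i),
    fun i => hp (hmem _), fun i => ?_⟩
  simp only [Function.iterate_succ_apply']
  exact hS _ (hmem i)

lemma mem_omX_of_iso {ω : Set D} (ho : SelfOrth ω) {X Y : D} (hX : X ∈ omX ω) (e : X ≅ Y) :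
    Y ∈ omX ω := by
  obtain ⟨W, hW, K, hK, hS⟩ := exists_ses_of_mem_omX hX
  exact mem_omX_of_ses ho (hS.of_iso_right e) hW hK

lemma zero_mem_omX {ω : Set D} (hω : IsAddClosed ω) : (0 : D) ∈ omX ω :=
  ⟨fun _ => 0, fun _ => 0, rfl, fun _ => hω.zero_mem,
    fun _ _ _ _ hi => extZero_of_isZero (isZero_zero D) hi, fun _ => SES.id_zero _⟩

lemma subset_omX {ω : Set D} (hω : IsAddClosed ω) (ho : SelfOrth ω) : ω ⊆ omX ω :=
  fun X hX => mem_omX_of_ses ho (SES.zero_id X) hX (zero_mem_omX hω)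

lemma hatCat_subset_omX {ω : Set D} (hω : IsAddClosed ω) (ho : SelfOrth ω) :
    hatCat ω ⊆ omX ω := by
  refine Set.iUnion_subset fun n => ?_
  induction n with
  | zero =>
    rintro X ⟨W, hW, ⟨e⟩⟩
    exact subset_omX hω ho (hω.of_iso hW e.symm)
  | succ n ih =>
    rintro X ⟨W, hW, K, hS, hK⟩
    exact mem_omX_of_ses ho hS hW (ih hK)

/-- The horseshoe step for an extension whose right-hand cover splits. -/
lemma SES.horseshoe {L Z M L' A F B : D} (h : SES L Z M) (hL : SES L' A L) (hM : SES F B M)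
    (he : extZero D 1 B L) : ∃ E, SES L' E F ∧ SES E (A ⊞ B) Z := by
  obtain ⟨P, h₁, h₂⟩ := h.pullback hM
  obtain ⟨e⟩ := h₁.nonempty_iso_biprod he
  exact (hL.biprod_right B).comp_epi (h₂.of_iso_mid e)

lemma omX_of_ses {ω : Set D} (hω : IsAddClosed ω) (ho : SelfOrth ω) {L Z M : D} (h : SES L Z M)
    (hL : L ∈ omX ω) (hM : M ∈ omX ω) : Z ∈ omX ω := by
  have hp := omX_subset_rightPerp ho
  suffices {Z | ∃ L ∈ omX ω, ∃ M ∈ omX ω, SES L Z M} ⊆ omX ω from this ⟨L, hL, M, hM, h⟩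
  refine subset_omX_of_forall_exists ?_ ?_
  · rintro Z ⟨L, hL, M, hM, h⟩ W hW i hi
    exact h.extZero_mid hi (hp hL W hW i hi) (hp hM W hW i hi)
  · rintro Z ⟨L, hL, M, hM, h⟩
    obtain ⟨A, hA, L', hL', h₁⟩ := exists_ses_of_mem_omX hL
    obtain ⟨B, hB, F, hF, h₂⟩ := exists_ses_of_mem_omX hM
    obtain ⟨E, h₃, h₄⟩ := h.horseshoe h₁ h₂ (hp hL B hB 1 le_rfl)
    exact ⟨_, hω.biprod_mem hA hB, E, ⟨_, hL', _, hF, h₃⟩, h₄⟩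

lemma biprod_mem_omX {ω : Set D} (hω : IsAddClosed ω) (ho : SelfOrth ω) {X Y : D}
    (hX : X ∈ omX ω) (hY : Y ∈ omX ω) : (X ⊞ Y) ∈ omX ω :=
  omX_of_ses hω ho (SES.biprod_inl X Y) hX hY

lemma omX_of_ses_of_left {ω : Set D} (hω : IsAddClosed ω) (ho : SelfOrth ω) {X Y Z : D}
    (h : SES X Y Z) (hX : X ∈ omX ω) (hY : Y ∈ omX ω) : Z ∈ omX ω := by
  obtain ⟨W, hW, K, hK, h₁⟩ := exists_ses_of_mem_omX hY
  obtain ⟨E, h₂, h₃⟩ := h₁.comp_epi h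
  exact mem_omX_of_ses ho h₃ hW (omX_of_ses hω ho h₂ hK hX)

lemma rightPerp_of_biprod {ω : Set D} {X Y : D} (h : (X ⊞ Y) ∈ rightPerp ω) : X ∈ rightPerp ω :=
  fun W hW i hi =>
    extZero_of_retract_target (retract_biprod_left X Y).some hi (h W hW i hi)

lemma omX_of_biprod {ω : Set D} (hω : IsAddClosed ω) (ho : SelfOrth ω) {X Y : D}
    (h : (X ⊞ Y) ∈ omX ω) : X ∈ omX ω := by
  suffices {X | ∃ Y, (X ⊞ Y) ∈ omX ω} ⊆ omX ω from this ⟨Y, h⟩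
  refine subset_omX_of_forall_exists ?_ ?_
  · rintro X ⟨Y, h⟩
    exact rightPerp_of_biprod (omX_subset_rightPerp ho h)
  · rintro X ⟨Y, h⟩
    obtain ⟨W, hW, K, hK, h₁⟩ := exists_ses_of_mem_omX h
    obtain ⟨E, h₂, h₃⟩ := h₁.comp_epi (SES.biprod_inr X Y)
    refine ⟨W, hW, E, ⟨X, ?_⟩, h₃⟩
    exact omX_of_ses hω ho (h₂.biprod_right X) hK (mem_omX_of_iso ho h (biprod.braiding _ _))

lemma mem_checkCat {𝒴 : Set D} {X : D} (hX : X ∈ 𝒴) : X ∈ checkCat 𝒴 :=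
  Set.mem_iUnion.2 ⟨0, X, hX, ⟨Iso.refl X⟩⟩

lemma mem_checkCat_of_ses {𝒴 : Set D} {M Y N : D} (h : SES M Y N) (hY : Y ∈ 𝒴)
    (hN : N ∈ checkCat 𝒴) : M ∈ checkCat 𝒴 := by
  obtain ⟨n, hn⟩ := Set.mem_iUnion.1 hN
  exact Set.mem_iUnion.2 ⟨n + 1, Y, hY, N, h, hn⟩

/-- Dévissage for `checkCat`. -/
lemma checkCat_induction {𝒴 𝒬 : Set D}
    (iso : ∀ {X Y : D}, Y ∈ 𝒴 → (X ≅ Y) → X ∈ 𝒬)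
    (ses : ∀ {M Y N : D}, SES M Y N → Y ∈ 𝒴 → N ∈ checkCat 𝒴 → N ∈ 𝒬 → M ∈ 𝒬) :
    checkCat 𝒴 ⊆ 𝒬 := by
  refine Set.iUnion_subset fun n => ?_
  induction n with
  | zero =>
    rintro X ⟨Y, hY, ⟨e⟩⟩
    exact iso hY e
  | succ n ih =>
    rintro X ⟨Y, hY, N, h, hN⟩
    exact ses h hY (Set.mem_iUnion.2 ⟨n, hN⟩) (ih hN)

lemma checkCat_mono {𝒴 𝒵 : Set D} (h : 𝒴 ⊆ 𝒵) : checkCat 𝒴 ⊆ checkCat 𝒵 :=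
  checkCat_induction (fun hY e => Set.mem_iUnion.2 ⟨0, _, h hY, ⟨e⟩⟩)
    fun hS hY _ hN => mem_checkCat_of_ses hS (h hY) hN

lemma exists_ses_of_mem_checkCat {τ : Set D} (hτ : IsAddClosed τ) {W : D}
    (hW : W ∈ checkCat τ) : ∃ T ∈ τ, ∃ V ∈ checkCat τ, SES W T V := by
  refine checkCat_induction (𝒬 := {W | ∃ T ∈ τ, ∃ V ∈ checkCat τ, SES W T V}) ?_ ?_ hW
  · intro X Y hY e
    exact ⟨X, hτ.of_iso hY e.symm, 0, mem_checkCat hτ.zero_mem, SES.id_zero X⟩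
  · intro M Y N h hY hN _
    exact ⟨Y, hY, N, hN, h⟩

lemma extZero_of_mem_checkCat {τ : Set D} {W Z : D} (hW : W ∈ checkCat τ)
    (hZ : Z ∈ rightPerp τ) {i : ℕ} (hi : i ≥ 1) : extZero D i W Z := by
  refine checkCat_induction (𝒬 := {W | ∀ i ≥ 1, extZero D i W Z}) ?_ ?_ hW i hi
  · intro X Y hY e i hi
    exact extZero_of_retract_source e.retract hi (hZ Y hY i hi)
  · intro M Y N h hY _ hN i hi
    exact h.extZero_source_left hi (hZ Y hY i hi) (hN _ (by omega))

lemma extZero_of_mem_resol {ω : Set D} {Z : D} (hZ : Z ∈ rightPerp ω) {n : ℕ} {X : D}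
    (hX : X ∈ resol ω n) {i : ℕ} (hi : n < i) : extZero D i X Z := by
  induction n generalizing X i with
  | zero =>
    obtain ⟨W, hW, ⟨e⟩⟩ := hX
    exact extZero_of_retract_source e.retract hi (hZ W hW i hi)
  | succ n ih =>
    obtain ⟨W, hW, K, h, hK⟩ := hX
    obtain ⟨i, rfl⟩ := Nat.exists_eq_add_of_le' (Nat.one_le_of_lt hi)
    exact h.extZero_source_right (by omega) (ih hK (by omega)) (hZ W hW _ (by omega))

lemma checkCat_of_ses {τ 𝒴 : Set D} (hτ : IsAddClosed τ) (hp : 𝒴 ⊆ rightPerp τ)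
    (hadd : ∀ Y ∈ 𝒴, ∀ T ∈ τ, (Y ⊞ T) ∈ 𝒴) (hsub : τ ⊆ 𝒴) {M P W : D} (h : SES M P W)
    (hM : M ∈ checkCat 𝒴) (hW : W ∈ checkCat τ) : P ∈ checkCat 𝒴 := by
  refine checkCat_induction (𝒬 := {M | ∀ P W, SES M P W → W ∈ checkCat τ → P ∈ checkCat 𝒴})
    ?_ ?_ hM P W h hW
  · intro X Y hY e P W h hW
    obtain ⟨T, hT, V, hV, hS⟩ := exists_ses_of_mem_checkCat hτ hW
    obtain ⟨e'⟩ := (h.of_iso_left e).nonempty_iso_biprod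
      (extZero_of_mem_checkCat hW (hp hY) le_rfl)
    exact mem_checkCat_of_ses ((hS.biprod_left Y).of_iso_left e'.symm) (hadd Y hY T hT)
      (checkCat_mono hsub hV)
  · intro M Y N hN hY _ ih P W h hW
    obtain ⟨T, hT, V, hV, hS⟩ := exists_ses_of_mem_checkCat hτ hW
    obtain ⟨P', h₁, h₂⟩ := h.pushout hN
    obtain ⟨e'⟩ := h₁.nonempty_iso_biprod (extZero_of_mem_checkCat hW (hp hY) le_rfl)
    obtain ⟨E, h₃, h₄⟩ := h₂.comp_mono ((hS.biprod_left Y).of_iso_left e'.symm)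
    exact mem_checkCat_of_ses h₃ (hadd Y hY T hT) (ih E V h₄ hV)

/-- The properties of the classes `ω = add C` and `τ = add T` attached to a tilting pair
`(C, T)`. -/
structure IsTiltingClassPair (ω τ : Set D) : Prop where
  addClosed_left : IsAddClosed ω
  addClosed_right : IsAddClosed τ
  selfOrth_left : SelfOrth ω
  selfOrth_right : SelfOrth τ
  right_subset : τ ⊆ omX ω
  rightPerp_subset : rightPerp τ ⊆ rightPerp ω
  exists_cover : ∀ X ∈ omX ω, ∃ W ∈ ω, W ∈ checkCat τ ∧ ∃ K ∈ omX ω, SES K W X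
  exists_bound : ∃ n, ∀ T ∈ τ, ∀ Z ∈ rightPerp ω, ∀ i > n, extZero D i T Z

namespace IsTiltingClassPair

variable {ω τ : Set D}

lemma checkCat_right_of_ses (h : IsTiltingClassPair ω τ) {M P W : D} (hS : SES M P W)
    (hM : M ∈ checkCat τ) (hW : W ∈ checkCat τ) : P ∈ checkCat τ :=
  checkCat_of_ses h.addClosed_right (fun X hX V hV => h.selfOrth_right V hV X hX)
    (fun _ hY _ hT => h.addClosed_right.biprod_mem hY hT) subset_rfl hS hM hW

lemma omX_right_subset (h : IsTiltingClassPair ω τ) : omX τ ⊆ omX ω := by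
  suffices {Z | ∃ L ∈ omX ω, ∃ M ∈ omX τ, SES L Z M} ⊆ omX ω from fun M hM =>
    this ⟨0, zero_mem_omX h.addClosed_left, M, hM, SES.zero_id M⟩
  have hω := omX_subset_rightPerp h.selfOrth_left
  refine subset_omX_of_forall_exists ?_ ?_
  · rintro Z ⟨L, hL, M, hM, hS⟩ W hW i hi
    exact hS.extZero_mid hi (hω hL W hW i hi)
      (h.rightPerp_subset (omX_subset_rightPerp h.selfOrth_right hM) W hW i hi)
  · rintro Z ⟨L, hL, M, hM, hS⟩
    obtain ⟨A, hA, L', hL', h₁⟩ := exists_ses_of_mem_omX hL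
    obtain ⟨T, hT, K, hK, h₂⟩ := exists_ses_of_mem_omX hM
    obtain ⟨B, hB, T', hT', h₃⟩ := exists_ses_of_mem_omX (h.right_subset hT)
    obtain ⟨F, h₄, h₅⟩ := h₃.comp_epi h₂
    obtain ⟨E, h₆, h₇⟩ := hS.horseshoe h₁ h₅ (hω hL B hB 1 le_rfl)
    obtain ⟨G, h₈, h₉⟩ := h₆.comp_epi h₄
    exact ⟨_, h.addClosed_left.biprod_mem hA hB, E,
      ⟨G, omX_of_ses h.addClosed_left h.selfOrth_left h₈ hL' hT', K, hK, h₉⟩, h₇⟩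

/-- Every object of `omX ω` embeds into an object with a long `τ`-presentation. -/
lemma exists_pres (h : IsTiltingClassPair ω τ) (k : ℕ) {M : D} (hM : M ∈ omX ω) :
    ∃ Q ∈ Pres (omX ω) τ k, ∃ W ∈ checkCat τ, W ∈ omX ω ∧ SES M Q W := by
  have hω := h.addClosed_left
  have ho := h.selfOrth_left
  induction k generalizing M with
  | zero =>
    exact ⟨M, hM, 0, mem_checkCat h.addClosed_right.zero_mem, zero_mem_omX hω, SES.id_zero M⟩
  | succ k ih =>
    obtain ⟨V, hV, hVτ, K, hK, h₁⟩ := h.exists_cover M hM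
    obtain ⟨U, hU, W, hW, hW', h₂⟩ := ih hK
    obtain ⟨P, h₃, h₄⟩ := h₁.pushout h₂
    obtain ⟨T, hT, P', hP', h₅⟩ := exists_ses_of_mem_checkCat h.addClosed_right
      (h.checkCat_right_of_ses h₄ hVτ hW)
    obtain ⟨Q, h₆, h₇⟩ := h₃.comp_mono h₅
    exact ⟨Q, ⟨T, hT, U, h₆, hU⟩, P', hP', omX_of_ses_of_left hω ho h₅
      (omX_of_ses hω ho h₄ (subset_omX hω ho hV) hW') (h.right_subset hT), h₇⟩

lemma pres_subset_omX (h : IsTiltingClassPair ω τ) (k : ℕ) : Pres (omX ω) τ k ⊆ omX ω := by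
  induction k with
  | zero => exact subset_rfl
  | succ k ih =>
    rintro Q ⟨T, hT, X, hS, hX⟩
    exact omX_of_ses_of_left h.addClosed_left h.selfOrth_left hS (ih hX) (h.right_subset hT)

lemma extZero_of_mem_pres (h : IsTiltingClassPair ω τ) {n : ℕ}
    (hn : ∀ T ∈ τ, ∀ Z ∈ rightPerp ω, ∀ i > n, extZero D i T Z) {k : ℕ} {Q : D}
    (hQ : Q ∈ Pres (omX ω) τ k) {T : D} (hT : T ∈ τ) {i : ℕ} (hi : i ≥ 1) (hik : i + k > n) :
    extZero D i T Q := by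
  induction k generalizing Q i with
  | zero => exact hn T hT Q (omX_subset_rightPerp h.selfOrth_left hQ) i hik
  | succ k ih =>
    obtain ⟨T', hT', X, hS, hX⟩ := hQ
    exact hS.extZero_right hi (h.selfOrth_right T hT T' hT' i hi) (ih hX (by omega) (by omega))

lemma mem_omX_right (h : IsTiltingClassPair ω τ) {M : D} (hM : M ∈ omX ω)
    (hM' : M ∈ rightPerp τ) : M ∈ omX τ := by
  obtain ⟨n, hn⟩ := h.exists_bound
  have hω := h.addClosed_left
  have ho := h.selfOrth_left
  suffices omX ω ∩ rightPerp τ ⊆ omX τ from this ⟨hM, hM'⟩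
  refine subset_omX_of_forall_exists Set.inter_subset_right ?_
  rintro M ⟨hM, hM'⟩
  obtain ⟨Q, hQ, W, hW, hW', h₁⟩ := h.exists_pres (n + 1) hM
  obtain ⟨e⟩ := h₁.nonempty_iso_biprod (extZero_of_mem_checkCat hW hM' le_rfl)
  have hWτ : W ∈ rightPerp τ := fun T hT i hi =>
    extZero_of_retract_target ((retract_biprod_left W M).some.trans
      ((biprod.braiding W M).trans e.symm).retract) hi
      (h.extZero_of_mem_pres hn hQ hT hi (by omega))
  obtain ⟨T, hT, L, h₂, hL⟩ := hQ
  obtain ⟨E, h₃, h₄⟩ := (h₂.of_iso_right e).comp_epi (SES.biprod_inr M W)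
  refine ⟨T, hT, E, ⟨omX_of_ses hω ho h₃ (h.pres_subset_omX n hL) hW', fun V hV i hi => ?_⟩, h₄⟩
  exact h₃.extZero_mid hi (h.extZero_of_mem_pres hn hL hV hi (by omega)) (hWτ V hV i hi)

lemma exists_omX_right (h : IsTiltingClassPair ω τ) {M : D} (hM : M ∈ omX ω) :
    ∃ Q ∈ omX τ, ∃ W ∈ checkCat τ, SES M Q W := by
  obtain ⟨n, hn⟩ := h.exists_bound
  obtain ⟨Q, hQ, W, hW, -, hS⟩ := h.exists_pres n hM
  exact ⟨Q, h.mem_omX_right (h.pres_subset_omX n hQ) fun T hT i hi =>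
    h.extZero_of_mem_pres hn hQ hT hi (by omega), W, hW, hS⟩

theorem checkCat_omX_eq (h : IsTiltingClassPair ω τ) :
    checkCat (omX τ) = checkCat (omX ω) := by
  have hτ := h.addClosed_right
  have ho := h.selfOrth_right
  have hsub := subset_omX hτ ho
  refine Set.Subset.antisymm (checkCat_mono h.omX_right_subset) (checkCat_induction ?_ ?_)
  · intro X Y hY e
    obtain ⟨Q, hQ, W, hW, hS⟩ := h.exists_omX_right hY
    exact mem_checkCat_of_ses (hS.of_iso_left e.symm) hQ (checkCat_mono hsub hW)
  · intro M Y N hS hY _ hN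
    obtain ⟨Q, hQ, W, hW, h₁⟩ := h.exists_omX_right hY
    obtain ⟨E, h₂, h₃⟩ := hS.comp_mono h₁
    exact mem_checkCat_of_ses h₂ hQ (checkCat_of_ses hτ (omX_subset_rightPerp ho)
      (fun X hX T hT => biprod_mem_omX hτ ho hX (hsub hT)) hsub h₃ hN hW)

end IsTiltingClassPair

lemma nsum_mem {T : D} {𝒳 : Set D} (hT : T ∈ 𝒳)
    (biprod_mem : ∀ {X Y : D}, X ∈ 𝒳 → Y ∈ 𝒳 → (X ⊞ Y) ∈ 𝒳) (n : ℕ) : nsum T n ∈ 𝒳 := by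
  induction n with
  | zero => exact hT
  | succ n ih => exact biprod_mem hT ih

lemma addOf_subset {T : D} {𝒳 : Set D} (hT : T ∈ 𝒳)
    (biprod_mem : ∀ {X Y : D}, X ∈ 𝒳 → Y ∈ 𝒳 → (X ⊞ Y) ∈ 𝒳)
    (of_iso : ∀ {X Y : D}, X ∈ 𝒳 → (X ≅ Y) → Y ∈ 𝒳)
    (of_biprod : ∀ {X Y : D}, (X ⊞ Y) ∈ 𝒳 → X ∈ 𝒳) : addOf T ⊆ 𝒳 := by
  rintro X ⟨n, Y, ⟨e⟩⟩
  exact of_biprod (of_iso (nsum_mem hT biprod_mem n) e.symm)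

lemma nonempty_nsum_biprod_iso (T : D) (n m : ℕ) :
    Nonempty ((nsum T n ⊞ nsum T m) ≅ nsum T (n + m + 1)) := by
  induction n with
  | zero => rw [zero_add]; exact ⟨Iso.refl _⟩
  | succ n ih =>
    obtain ⟨e⟩ := ih
    rw [add_right_comm n 1 m]
    exact ⟨biprod.associator _ _ _ ≪≫ biprod.mapIso (Iso.refl T) e⟩

/-- Interchange of the two middle summands. -/
def biprodInterchange (X X' Y Y' : D) : (X ⊞ X') ⊞ (Y ⊞ Y') ≅ (X ⊞ Y) ⊞ (X' ⊞ Y') where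
  hom := biprod.lift (biprod.map biprod.fst biprod.fst) (biprod.map biprod.snd biprod.snd)
  inv := biprod.lift (biprod.map biprod.fst biprod.fst) (biprod.map biprod.snd biprod.snd)

lemma self_mem_addOf (T : D) : T ∈ addOf T :=
  ⟨0, 0, ⟨(isoBiprodZero (isZero_zero D)).symm⟩⟩

lemma isAddClosed_addOf (T : D) : IsAddClosed (addOf T) where
  zero_mem := ⟨0, T, ⟨(isoZeroBiprod (isZero_zero D)).symm⟩⟩
  of_iso := by
    rintro X X' ⟨n, Y, ⟨e⟩⟩ a
    exact ⟨n, Y, ⟨biprod.mapIso a.symm (Iso.refl Y) ≪≫ e⟩⟩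
  biprod_mem := by
    rintro X X' ⟨n, Y, ⟨e⟩⟩ ⟨m, Y', ⟨e'⟩⟩
    obtain ⟨a⟩ := nonempty_nsum_biprod_iso T n m
    exact ⟨_, Y ⊞ Y', ⟨biprodInterchange X X' Y Y' ≪≫ biprod.mapIso e e' ≪≫ a⟩⟩

lemma extZero_of_mem_addOf_source {T W Z : D} (hW : W ∈ addOf T) {i : ℕ} (hi : i ≥ 1)
    (h : extZero D i T Z) : extZero D i W Z :=
  addOf_subset (𝒳 := {W | extZero D i W Z}) h
    (fun hX hY => (SES.biprod_inl _ _).extZero_source_mid hi hX hY)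
    (fun hX e => extZero_of_retract_source e.symm.retract hi hX)
    (fun {X Y} hX => extZero_of_retract_source (retract_biprod_left X Y).some hi hX) hW

lemma extZero_of_mem_addOf_target {T W Z : D} (hW : W ∈ addOf T) {i : ℕ} (hi : i ≥ 1)
    (h : extZero D i Z T) : extZero D i Z W :=
  addOf_subset (𝒳 := {W | extZero D i Z W}) h
    (fun hX hY => (SES.biprod_inl _ _).extZero_mid hi hX hY)
    (fun hX e => extZero_of_retract_target e.symm.retract hi hX)
    (fun {X Y} hX => extZero_of_retract_target (retract_biprod_left X Y).some hi hX) hW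

lemma selfOrth_addOf {T : D} (h : ∀ i ≥ 1, extZero D i T T) : SelfOrth (addOf T) :=
  fun _ hW _ hW' i hi => extZero_of_mem_addOf_source hW hi
    (extZero_of_mem_addOf_target hW' hi (h i hi))

theorem isTiltingClassPair_addOf {X T : D} (hX : ∀ i ≥ 1, extZero D i X X)
    (hT : ∀ i ≥ 1, extZero D i T T) (hTX : T ∈ hatCat (addOf X)) (hXT : X ∈ checkCat (addOf T)) :
    IsTiltingClassPair (addOf X) (addOf T) where
  addClosed_left := isAddClosed_addOf X
  addClosed_right := isAddClosed_addOf T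
  selfOrth_left := selfOrth_addOf hX
  selfOrth_right := selfOrth_addOf hT
  right_subset := by
    have hω := isAddClosed_addOf X
    have ho := selfOrth_addOf hX
    exact addOf_subset (hatCat_subset_omX hω ho hTX) (biprod_mem_omX hω ho)
      (mem_omX_of_iso ho) (omX_of_biprod hω ho)
  rightPerp_subset := fun Z hZ W hW i hi =>
    extZero_of_mem_addOf_source hW hi (extZero_of_mem_checkCat hXT hZ hi)
  exists_cover := by
    intro M hM
    obtain ⟨W, ⟨n, V, ⟨e⟩⟩, K, hK, hS⟩ := exists_ses_of_mem_omX hM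
    have hω := isAddClosed_addOf X
    have hτ := isAddClosed_addOf T
    have hV : V ∈ addOf X := ⟨n, W, ⟨biprod.braiding _ _ ≪≫ e⟩⟩
    refine ⟨nsum X n, nsum_mem (self_mem_addOf X) hω.biprod_mem n, nsum_mem hXT ?_ n, V ⊞ K,
      biprod_mem_omX hω (selfOrth_addOf hX) (subset_omX hω (selfOrth_addOf hX) hV) hK,
      (hS.biprod_left V).of_iso_mid (biprod.braiding _ _ ≪≫ e)⟩
    exact fun hY hY' => checkCat_of_ses hτ
      (fun Z hZ Z' hZ' => selfOrth_addOf hT Z' hZ' Z hZ)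
      (fun _ hZ _ hZ' => hτ.biprod_mem hZ hZ') subset_rfl (SES.biprod_inl _ _) hY hY'
  exists_bound := by
    obtain ⟨n, hn⟩ := Set.mem_iUnion.1 hTX
    exact ⟨n, fun W hW Z hZ i hi => extZero_of_mem_addOf_source hW (by omega)
      (extZero_of_mem_resol hZ hn hi)⟩

end RelativeResolutions

section ArtinAlgebra

variable {R : Type} [CommRing R] [IsArtinianRing R]
variable {A : Type} [Ring A] [Algebra R A] [Module.Finite R A]
variable [Abelian (FGModuleCat A)] [EnoughProjectives (FGModuleCat A)]
variable [EnoughInjectives (FGModuleCat A)]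

theorem stmt15 (Cm Tm : FGModuleCat A) (htilt : TiltingPair A Cm Tm) :
    checkCat (omX (addOf Tm)) = checkCat (omX (addOf Cm)) := by
  obtain ⟨hC, hT, hTC, hCT⟩ := htilt
  exact (isTiltingClassPair_addOf hC hT hTC hCT).checkCat_omX_eq

end ArtinAlgebra
end
end
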